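/- ρ-zCDP with pre-processing implies P-PRzCDP (unit splitting, Lemma 7): Let T and T* be record sets, let A : T → (finite multisets over T*) be a pre-processing function, and extend A to databases by Â(D) = the multiset union (bind) of A(r) over all records r in D (with multiplicity). Let M be a mechanism mapping databases over T* to probability measures on a measurable space Y that satisfies ρ-zCDP. Then the mechanism D ↦ M(Â(D)) on databases over T satisfies P-PRzCDP with policy function P(r) = ρ · |A(r)|², where |A(r)| is the cardinality of the multiset A(r). -/

import Mathlib

open MeasureTheory ProbabilityTheory
open scoped Classical NNReal

/-- Rényi divergence of order `α` between two measures. -/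
noncomputable def renyiDiv {X : Type*} [MeasurableSpace X] (α : ℝ) (P Q : Measure X) : EReal :=
  if P ≪ Q then (((α - 1)⁻¹ : ℝ) : EReal) * ENNReal.log (∫⁻ x, P.rnDeriv Q x ^ α ∂Q)
  else ⊤

/-- Databases `D` and `D'` differ in the single record `r`. -/
def Neighbors {T : Type*} (D D' : Multiset T) (r : T) : Prop :=
  D' = r ::ₘ D ∨ D = r ::ₘ D'

/-- Per-record zero-concentrated differential privacy with policy function `P`. -/
def PRzCDP {T Y : Type*} [MeasurableSpace Y] (M : Multiset T → Measure Y) (P : T → ℝ) : Prop :=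
  ∀ α : ℝ, 1 < α → ∀ (D D' : Multiset T) (r : T), Neighbors D D' r →
    renyiDiv α (M D) (M D') ≤ ((α * P r : ℝ) : EReal)

/-- Zero-concentrated differential privacy with privacy-loss parameter `ρ`. -/
def zCDP {T Y : Type*} [MeasurableSpace Y] (M : Multiset T → Measure Y) (ρ : ℝ) : Prop :=
  ∀ α : ℝ, 1 < α → ∀ (D D' : Multiset T) (r : T), Neighbors D D' r →
    renyiDiv α (M D) (M D') ≤ ((ρ * α : ℝ) : EReal)

/-- A Rényi divergence bound amounts to absolute continuity and a bound on the `α`-th moment of the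
density. -/
lemma renyiDiv_le_coe_iff {X : Type*} [MeasurableSpace X] {α : ℝ} (hα : 1 < α) (P Q : Measure X)
    (c : ℝ) :
    renyiDiv α P Q ≤ (c : EReal) ↔
      P ≪ Q ∧ ∫⁻ x, P.rnDeriv Q x ^ α ∂Q ≤ ENNReal.ofReal (Real.exp ((α - 1) * c)) := by
  have hα' : 0 < α - 1 := sub_pos.2 hα
  unfold renyiDiv
  split_ifs with h
  · have hlog : ENNReal.log (ENNReal.ofReal (Real.exp ((α - 1) * c))) =
        (((α - 1) * c : ℝ) : EReal) := by
      rw [← EReal.exp_coe, EReal.log_exp]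
    rw [← ENNReal.log_le_log_iff, hlog]
    simp only [h, true_and]
    rw [EReal.coe_inv, ← EReal.div_eq_inv_mul,
      EReal.div_le_iff_le_mul (by exact_mod_cast hα') (EReal.coe_ne_top _), EReal.coe_mul]
  · simp [h]

/-- Hölder's inequality for the moments of a density that factors through an intermediate
measure. -/
lemma lintegral_rnDeriv_rpow_le_mul {X : Type*} [MeasurableSpace X] {P S Q : Measure X}
    [IsFiniteMeasure P] [IsFiniteMeasure S] [IsFiniteMeasure Q] (hPS : P ≪ S) (hSQ : S ≪ Q)
    {α u v : ℝ} (hα : 1 < α) (huv : u.HolderConjugate v) :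
    ∫⁻ x, P.rnDeriv Q x ^ α ∂Q ≤
      (∫⁻ x, P.rnDeriv S x ^ (α * u) ∂S) ^ (1 / u) *
        (∫⁻ x, S.rnDeriv Q x ^ (1 + (α - 1) * v) ∂Q) ^ (1 / v) := by
  have hu : 0 < u := huv.pos
  have hv : 0 < v := huv.symm.pos
  have hsum : u⁻¹ + v⁻¹ = 1 := huv.inv_add_inv_eq_one
  have hs : 0 ≤ α - 1 / u := by
    have : 0 < v⁻¹ := inv_pos.2 hv
    rw [one_div]; linarith
  have hexp : (α - 1 / u) * v = 1 + (α - 1) * v := by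
    have : u⁻¹ = 1 - v⁻¹ := by linarith
    rw [one_div, this]; field_simp; ring
  calc ∫⁻ x, P.rnDeriv Q x ^ α ∂Q
      = ∫⁻ x, (P.rnDeriv S x ^ α * S.rnDeriv Q x ^ (1 / u)) * S.rnDeriv Q x ^ (α - 1 / u) ∂Q := by
        refine lintegral_congr_ae ?_
        filter_upwards [Measure.rnDeriv_mul_rnDeriv (κ := Q) hPS] with x hx
        rw [← hx, Pi.mul_apply, ENNReal.mul_rpow_of_nonneg _ _ (by linarith), mul_assoc,
          ← ENNReal.rpow_add_of_nonneg _ _ (by positivity) hs, add_sub_cancel]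
    _ ≤ (∫⁻ x, (P.rnDeriv S x ^ α * S.rnDeriv Q x ^ (1 / u)) ^ u ∂Q) ^ (1 / u) *
          (∫⁻ x, (S.rnDeriv Q x ^ (α - 1 / u)) ^ v ∂Q) ^ (1 / v) :=
        ENNReal.lintegral_mul_le_Lp_mul_Lq Q huv (by fun_prop) (by fun_prop)
    _ = _ := by
        congr 2
        · rw [← lintegral_rnDeriv_mul hSQ
            ((Measure.measurable_rnDeriv P S).pow_const _).aemeasurable]
          refine lintegral_congr fun x => ?_
          rw [ENNReal.mul_rpow_of_nonneg _ _ hu.le, ← ENNReal.rpow_mul, ← ENNReal.rpow_mul,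
            one_div, inv_mul_cancel₀ hu.ne', ENNReal.rpow_one, mul_comm]
        · simp_rw [← ENNReal.rpow_mul, hexp]

/-- Square roots of concentrated privacy losses add up along a chain of measures. -/
lemma renyiDiv_le_of_le_of_le {X : Type*} [MeasurableSpace X] {P S Q : Measure X}
    [IsFiniteMeasure P] [IsFiniteMeasure S] [IsFiniteMeasure Q] {ρ m n : ℝ}
    (hm : 0 < m) (hn : 0 < n)
    (hPS : ∀ α : ℝ, 1 < α → renyiDiv α P S ≤ ((α * (ρ * m ^ 2) : ℝ) : EReal))
    (hSQ : ∀ α : ℝ, 1 < α → renyiDiv α S Q ≤ ((α * (ρ * n ^ 2) : ℝ) : EReal))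
    {α : ℝ} (hα : 1 < α) :
    renyiDiv α P Q ≤ ((α * (ρ * (m + n) ^ 2) : ℝ) : EReal) := by
  have hα₀ : 0 < α := by linarith
  have hα₁ : 0 < α - 1 := by linarith
  set t : ℝ := n * (α - 1) / (m * α) with ht_def
  have ht : 0 < t := by positivity
  have huv : (1 + t).HolderConjugate (1 + t⁻¹) := by
    rw [Real.holderConjugate_iff]
    refine ⟨by linarith, ?_⟩
    field_simp
    ring
  have hβ : 1 < α * (1 + t) := by nlinarith
  have hγ : 1 < 1 + (α - 1) * (1 + t⁻¹) := by
    have : 0 < (α - 1) * (1 + t⁻¹) := by positivity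
    linarith
  obtain ⟨hPS_ac, hPS_le⟩ := (renyiDiv_le_coe_iff hβ _ _ _).1 (hPS _ hβ)
  obtain ⟨hSQ_ac, hSQ_le⟩ := (renyiDiv_le_coe_iff hγ _ _ _).1 (hSQ _ hγ)
  refine (renyiDiv_le_coe_iff hα _ _ _).2 ⟨hPS_ac.trans hSQ_ac, ?_⟩
  refine (lintegral_rnDeriv_rpow_le_mul hPS_ac hSQ_ac hα huv).trans ?_
  refine (mul_le_mul' (ENNReal.rpow_le_rpow hPS_le (by positivity))
    (ENNReal.rpow_le_rpow hSQ_le (by positivity))).trans_eq ?_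
  rw [ENNReal.ofReal_rpow_of_pos (Real.exp_pos _), ENNReal.ofReal_rpow_of_pos (Real.exp_pos _),
    ← Real.exp_mul, ← Real.exp_mul, ← ENNReal.ofReal_mul (Real.exp_pos _).le, ← Real.exp_add]
  congr 2
  have hleft : (α * (1 + t) - 1) * (α * (1 + t) * (ρ * m ^ 2)) * (1 / (1 + t)) =
      (α * (1 + t) - 1) * α * (ρ * m ^ 2) := by
    field_simp
  have hright : (1 + (α - 1) * (1 + t⁻¹) - 1) * ((1 + (α - 1) * (1 + t⁻¹)) * (ρ * n ^ 2)) *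
      (1 / (1 + t⁻¹)) = (α - 1) * (1 + (α - 1) * (1 + t⁻¹)) * (ρ * n ^ 2) := by
    rw [add_sub_cancel_left]
    field_simp
  rw [hleft, hright, ht_def]
  field_simp
  ring

/-- The Rényi divergence of a probability measure from itself is nonpositive. -/
lemma renyiDiv_self_le {X : Type*} [MeasurableSpace X] (P : Measure X) [IsProbabilityMeasure P]
    {α : ℝ} (hα : 1 < α) : renyiDiv α P P ≤ ((0 : ℝ) : EReal) := by
  refine (renyiDiv_le_coe_iff hα _ _ _).2 ⟨Measure.AbsolutelyContinuous.rfl, ?_⟩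
  have : ∫⁻ x, P.rnDeriv P x ^ α ∂P = ∫⁻ _, 1 ∂P := by
    refine lintegral_congr_ae ?_
    filter_upwards [Measure.rnDeriv_self P] with x hx
    simp [hx]
  simp [this]

/-- Group privacy: adding or removing `k` records costs a factor `k ^ 2`. -/
lemma zCDP.renyiDiv_add_le {T Y : Type*} [MeasurableSpace Y] {M : Multiset T → Measure Y}
    (hMprob : ∀ D, IsProbabilityMeasure (M D)) {ρ : ℝ} (hM : zCDP M ρ) (D s : Multiset T) :
    ∀ α : ℝ, 1 < α →
      renyiDiv α (M D) (M (s + D)) ≤ ((α * (ρ * (Multiset.card s : ℝ) ^ 2) : ℝ) : EReal) ∧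
      renyiDiv α (M (s + D)) (M D) ≤ ((α * (ρ * (Multiset.card s : ℝ) ^ 2) : ℝ) : EReal) := by
  induction s using Multiset.induction_on with
  | empty =>
    intro α hα
    simpa using renyiDiv_self_le (M D) hα
  | cons a s ih =>
    intro α hα
    have hadd : ∀ α : ℝ, 1 < α →
        renyiDiv α (M (s + D)) (M (a ::ₘ s + D)) ≤ ((α * (ρ * 1 ^ 2) : ℝ) : EReal) := by
      intro α hα
      simpa [mul_comm] using hM α hα _ _ a (Or.inl (Multiset.cons_add a s D))
    have hremove : ∀ α : ℝ, 1 < α →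
        renyiDiv α (M (a ::ₘ s + D)) (M (s + D)) ≤ ((α * (ρ * 1 ^ 2) : ℝ) : EReal) := by
      intro α hα
      simpa [mul_comm] using hM α hα _ _ a (Or.inr (Multiset.cons_add a s D))
    rcases s.empty_or_exists_mem with rfl | ⟨b, hb⟩
    · simpa using And.intro (hadd α hα) (hremove α hα)
    · have hs : (0 : ℝ) < Multiset.card s := by
        exact_mod_cast Multiset.card_pos_iff_exists_mem.2 ⟨b, hb⟩
      rw [Multiset.card_cons, Nat.cast_succ]
      refine ⟨renyiDiv_le_of_le_of_le hs one_pos (fun β hβ => (ih β hβ).1) hadd hα, ?_⟩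
      rw [add_comm (Multiset.card s : ℝ) 1]
      exact renyiDiv_le_of_le_of_le one_pos hs hremove (fun β hβ => (ih β hβ).2) hα

/-- ρ-zCDP with pre-processing implies P-PRzCDP (unit splitting, Lemma 7). -/
theorem zcdp_preprocessing_implies_przcdp {T Tstar Y : Type*} [MeasurableSpace Y]
    (A : T → Multiset Tstar)
    (M : Multiset Tstar → Measure Y) (hMprob : ∀ D, IsProbabilityMeasure (M D))
    (ρ : ℝ) (hρ : 0 ≤ ρ) (hM : zCDP M ρ) :
    PRzCDP (fun D => M (D.bind A)) (fun r => ρ * (Multiset.card (A r) : ℝ) ^ 2) := by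
  rintro α hα D D' r (rfl | rfl)
  · simpa only [Multiset.cons_bind] using (hM.renyiDiv_add_le hMprob (D.bind A) (A r) α hα).1
  · simpa only [Multiset.cons_bind] using (hM.renyiDiv_add_le hMprob (D'.bind A) (A r) α hα).2
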